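/- Let $a,b,r>0$. Let $B\sim\mathrm{Beta}(a,b)$ (density $x^{a-1}(1-x)^{b-1}/B(a,b)$ on $(0,1)$) and $G\sim\Gamma(r,1)$ (density $x^{r-1}e^{-x}/\Gamma(r)$ on $(0,\infty)$) be independent, and set $Y=BG$. Define the operator $$\mathcal{S}f(y)=y^2f''(y)+\big((a+r+1)y-y^2\big)f'(y)+\big(ar-(a+b)y\big)f(y),$$ and let $\mathcal{F}_{\mathcal{S},Y}$ be the set of all twice continuously differentiable functions $f:(0,\infty)\to\mathbb{R}$ such that $\mathbb{E}|Y^jf^{(t)}(Y)|<\infty$ for all $t,j\in\{0,1,2\}$. Let $W$ be a real-valued random variable with $\mathbb{E}[W^2]<\infty$. Then the following are equivalent: 1. $W$ is equal in law to $BG$. 2. $\mathbb{E}[\mathcal{S}f(W)]=0$ for all $f\in\mathcal{F}_{\mathcal{S},Y}$; here it is understood that $\mathcal{S}f(W)$ is well defined, that is, $W\in(0,\infty)$ almost surely and $\mathcal{S}f(W)$ is integrable for all these $f$. 3. $\mathbb{E}[\mathcal{S}f(W)]=0$ for all twice continuously differentiable $f:\mathbb{R}\to\mathbb{R}$ whose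 restriction to $(0,\infty)$ lies in $\mathcal{F}_{\mathcal{S},Y}$ and for which $\mathcal{S}f(W)$ is integrable. -/

import Mathlib

open MeasureTheory ProbabilityTheory

/-- The Stein operator
`S f y = y² f''(y) + ((a + r + 1) y - y²) f'(y) + (a r - (a + b) y) f(y)`
for the product of independent `Beta(a, b)` and `Γ(r, 1)` random variables. -/
noncomputable def steinBetaGamma (a b r : ℝ) (f : ℝ → ℝ) (y : ℝ) : ℝ :=
  y ^ 2 * iteratedDeriv 2 f y
    + ((a + r + 1) * y - y ^ 2) * iteratedDeriv 1 f y
    + (a * r - (a + b) * y) * f y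

/-- The class `F_{S,Y}` of an operator of order `T` whose polynomial coefficients have maximal
degree `m`, for a random variable `Y` supported on the open set `I`: functions that are `C^T` on
`I` with `E|Y^j f^(t)(Y)| < ∞` for `t ≤ T`, `j ≤ m`. A function on `I` is represented by a total
function, whose values off `I` are unconstrained. As `I` is open, the derivatives at points
of `I` only depend on the restriction to `I`. -/
def steinClass (T m : ℕ) (I : Set ℝ) {Ω : Type*} [MeasurableSpace Ω] (μ : Measure Ω)
    (Y : Ω → ℝ) : Set (ℝ → ℝ) :=
  {f | ContDiffOn ℝ T f I ∧
    ∀ t ≤ T, ∀ j ≤ m, Integrable (fun ω => Y ω ^ j * iteratedDeriv t f (Y ω)) μ}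

theorem measurable_gammaPDF (a r : ℝ) : Measurable (gammaPDF a r) :=
  (measurable_gammaPDFReal a r).ennreal_ofReal

theorem measurable_betaPDF (a b : ℝ) : Measurable (betaPDF a b) :=
  (measurable_betaPDFReal a b).ennreal_ofReal

theorem integral_gammaMeasure_one {r : ℝ} (hr : 0 < r) (h : ℝ → ℝ) :
    ∫ x, h x ∂(gammaMeasure r 1) =
      (1 / Real.Gamma r) * ∫ x in Set.Ioi 0, (x ^ (r - 1) * Real.exp (-x)) * h x := by
  rw [gammaMeasure, integral_withDensity_eq_integral_toReal_smul
    (measurable_gammaPDF r 1) (by simp [gammaPDF])]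
  rw [← setIntegral_eq_integral_of_forall_compl_eq_zero (s := Set.Ici 0),
    integral_Ici_eq_integral_Ioi, ← integral_const_mul]
  · refine setIntegral_congr_fun measurableSet_Ioi fun x hx => ?_
    simp only [gammaPDF, ENNReal.toReal_ofReal (gammaPDFReal_nonneg hr one_pos x), smul_eq_mul]
    simp only [gammaPDFReal, if_pos (le_of_lt (Set.mem_Ioi.1 hx)), Real.one_rpow, one_mul]
    ring
  · intro x hx
    simp [gammaPDF_of_neg (not_le.1 (fun h => hx (Set.mem_Ici.2 h)))]

theorem integral_betaMeasure {a b : ℝ} (ha : 0 < a) (hb : 0 < b) (h : ℝ → ℝ) :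
    ∫ x, h x ∂(betaMeasure a b) =
      (1 / beta a b) * ∫ x in Set.Ioo 0 1, (x ^ (a - 1) * (1 - x) ^ (b - 1)) * h x := by
  rw [betaMeasure, integral_withDensity_eq_integral_toReal_smul
    (measurable_betaPDF a b) (by simp [betaPDF])]
  rw [← setIntegral_eq_integral_of_forall_compl_eq_zero (s := Set.Ioo 0 1), ← integral_const_mul]
  · refine setIntegral_congr_fun measurableSet_Ioo fun x hx => ?_
    simp only [betaPDF, ENNReal.toReal_ofReal (betaPDFReal_pos hx.1 hx.2 ha hb).le, smul_eq_mul]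
    simp only [betaPDFReal, if_pos (show 0 < x ∧ x < 1 from hx)]
    ring
  · intro x hx
    have : betaPDFReal a b x = 0 := if_neg hx
    simp [betaPDF, this]

theorem integrableOn_beta_density {a b : ℝ} (ha : 0 < a) (hb : 0 < b) :
    IntegrableOn (fun x : ℝ => x ^ (a - 1) * (1 - x) ^ (b - 1)) (Set.Ioo 0 1) := by
  have h1 : Integrable (betaPDFReal a b) := by
    refine ⟨by fun_prop, ?_⟩
    rw [hasFiniteIntegral_iff_ofReal]
    · exact (lintegral_betaPDF_eq_one ha hb).trans_lt (by simp)
    · refine ae_of_all _ fun x => ?_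
      by_cases hx : 0 < x ∧ x < 1
      · exact (betaPDFReal_pos hx.1 hx.2 ha hb).le
      · simp [betaPDFReal, if_neg hx]
  refine ((h1.const_mul (beta a b)).integrableOn (s := Set.Ioo 0 1)).congr_fun (fun x hx => ?_)
    measurableSet_Ioo
  simp only [betaPDFReal, if_pos (show 0 < x ∧ x < 1 from hx)]
  field_simp [(beta_pos ha hb).ne']

theorem integrable_pow_gammaMeasure {r : ℝ} (hr : 0 < r) (n : ℕ) :
    Integrable (fun x : ℝ => x ^ n) (gammaMeasure r 1) := by
  rw [gammaMeasure, integrable_withDensity_iff (measurable_gammaPDF r 1)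
    (by simp [gammaPDF])]
  have key : IntegrableOn (fun x : ℝ => x ^ n * (gammaPDF r 1 x).toReal) (Set.Ioi 0) := by
    have h0 := (Real.GammaIntegral_convergent (s := r + n) (by positivity)).const_mul
      (1 / Real.Gamma r)
    refine IntegrableOn.congr_fun h0 (fun x hx => ?_) measurableSet_Ioi
    have hx' : (0 : ℝ) < x := hx
    simp only [gammaPDF, ENNReal.toReal_ofReal (gammaPDFReal_nonneg hr one_pos x)]
    simp only [gammaPDFReal, if_pos hx'.le, Real.one_rpow, one_mul]
    rw [show r + n - 1 = (r - 1) + n by ring, Real.rpow_add hx', Real.rpow_natCast]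
    ring
  rw [← integrableOn_Ici_iff_integrableOn_Ioi] at key
  refine (integrableOn_iff_integrable_of_support_subset (s := Set.Ici 0) ?_).1 key
  intro x hx
  by_contra hx'
  exact hx (by simp [gammaPDF_of_neg (not_le.1 (fun h => hx' (Set.mem_Ici.2 h)))])

theorem gammaMeasure_ae_pos {r : ℝ} : ∀ᵐ x ∂(gammaMeasure r 1), 0 < x := by
  rw [gammaMeasure, ae_withDensity_iff (measurable_gammaPDF r 1)]
  filter_upwards [Measure.ae_ne volume (0 : ℝ)] with x hx h
  refine lt_of_le_of_ne ?_ hx.symm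
  by_contra h0
  exact h (gammaPDF_of_neg (not_le.1 h0))

theorem betaMeasure_ae_mem_Ioo {a b : ℝ} : ∀ᵐ x ∂(betaMeasure a b), x ∈ Set.Ioo (0 : ℝ) 1 := by
  rw [betaMeasure, ae_withDensity_iff (measurable_betaPDF a b)]
  refine ae_of_all _ fun x h => ?_
  by_contra h0
  exact h (by simp [betaPDF, betaPDFReal, if_neg (show ¬ (0 < x ∧ x < 1) from h0)])

/-- Stein identity of the gamma distribution. -/
theorem integral_gammaMeasure_stein {r : ℝ} (hr : 0 < r) {h : ℝ → ℝ} (hh : ContDiff ℝ 1 h)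
    (hc : HasCompactSupport h) :
    ∫ x, (x * deriv h x + (r - x) * h x) ∂(gammaMeasure r 1) = 0 := by
  rw [integral_gammaMeasure_one hr]
  have hd : Continuous (deriv h) := hh.continuous_deriv le_rfl
  have hcont : Continuous fun x => x * deriv h x + (r - x) * h x := by
    have := hh.continuous
    fun_prop
  have hsupp : HasCompactSupport fun x => x * deriv h x + (r - x) * h x :=
    (hc.deriv.mul_left).add hc.mul_left
  obtain ⟨C, hC⟩ := hsupp.exists_bound_of_continuous hcont
  have hF : ∀ x ∈ Set.Ioi (0 : ℝ), HasDerivAt (fun x => x ^ r * Real.exp (-x) * h x)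
      (x ^ (r - 1) * Real.exp (-x) * (x * deriv h x + (r - x) * h x)) x := by
    intro x hx
    have hx' : (0 : ℝ) < x := hx
    have h1 := Real.hasDerivAt_rpow_const (x := x) (p := r) (Or.inl hx'.ne')
    have h2 := (hasDerivAt_neg x).exp
    have h3 := (hh.differentiable one_ne_zero x).hasDerivAt
    refine ((h1.mul h2).mul h3).congr_deriv ?_
    have : x ^ r = x ^ (r - 1) * x := by
      rw [← Real.rpow_add_one hx'.ne']; simp
    simp only [Pi.mul_apply, this]
    ring
  have hI : IntegrableOn (fun x => x ^ (r - 1) * Real.exp (-x) * (x * deriv h x + (r - x) * h x))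
      (Set.Ioi 0) := by
    have h0 := Real.GammaIntegral_convergent hr
    refine (Integrable.mul_bdd (c := C) h0 hcont.aestronglyMeasurable
      (ae_of_all _ hC)).congr (ae_of_all _ fun x => ?_)
    simp only
    ring
  have hcF : Continuous fun x => x ^ r * Real.exp (-x) * h x := by
    have := Real.continuous_rpow_const hr.le
    have := hh.continuous
    fun_prop
  have hlim : Filter.Tendsto (fun x => x ^ r * Real.exp (-x) * h x) Filter.atTop (nhds 0) := by
    have hs : HasCompactSupport fun x => x ^ r * Real.exp (-x) * h x := hc.mul_left
    exact hs.is_zero_at_infty.mono_left atTop_le_cocompact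
  rw [integral_Ioi_of_hasDerivAt_of_tendsto hcF.continuousWithinAt hF hI hlim]
  simp [Real.zero_rpow hr.ne']

/-- Stein identity of the beta distribution. -/
theorem integral_betaMeasure_stein {a b : ℝ} (ha : 0 < a) (hb : 0 < b) {h : ℝ → ℝ}
    (hh : ContDiff ℝ 1 h) :
    ∫ x, (x * (1 - x) * deriv h x + (a - (a + b) * x) * h x) ∂(betaMeasure a b) = 0 := by
  rw [integral_betaMeasure ha hb]
  have hd : Continuous (deriv h) := hh.continuous_deriv le_rfl
  have hcont : Continuous fun x => x * (1 - x) * deriv h x + (a - (a + b) * x) * h x := by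
    have := hh.continuous
    fun_prop
  obtain ⟨C, hC⟩ := (isCompact_Icc (a := (0 : ℝ)) (b := 1)).exists_bound_of_continuousOn
    hcont.continuousOn
  have hF : ∀ x ∈ Set.Ioo (0 : ℝ) 1, HasDerivAt (fun x => x ^ a * (1 - x) ^ b * h x)
      (x ^ (a - 1) * (1 - x) ^ (b - 1) *
        (x * (1 - x) * deriv h x + (a - (a + b) * x) * h x)) x := by
    intro x hx
    have hx1 : 0 < 1 - x := sub_pos.2 hx.2
    have h1 := Real.hasDerivAt_rpow_const (x := x) (p := a) (Or.inl hx.1.ne')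
    have h2 := ((hasDerivAt_id x).const_sub 1).rpow_const (p := b) (Or.inl hx1.ne')
    have h3 := (hh.differentiable one_ne_zero x).hasDerivAt
    refine ((h1.mul h2).mul h3).congr_deriv ?_
    have e1 : x ^ a = x ^ (a - 1) * x := by
      rw [← Real.rpow_add_one hx.1.ne']; simp
    have e2 : (1 - x) ^ b = (1 - x) ^ (b - 1) * (1 - x) := by
      rw [← Real.rpow_add_one hx1.ne']; simp
    simp only [Pi.mul_apply, e1, e2, id]
    ring
  have hI : IntegrableOn (fun x => x ^ (a - 1) * (1 - x) ^ (b - 1) *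
      (x * (1 - x) * deriv h x + (a - (a + b) * x) * h x)) (Set.Ioo 0 1) :=
    Integrable.mul_bdd (c := C) (integrableOn_beta_density ha hb) hcont.aestronglyMeasurable
      ((ae_restrict_mem measurableSet_Ioo).mono fun x hx => hC x (Set.Ioo_subset_Icc_self hx))
  have hcF : Continuous fun x => x ^ a * (1 - x) ^ b * h x := by
    have h1 := Real.continuous_rpow_const ha.le
    have h2 := (Real.continuous_rpow_const hb.le).comp (continuous_sub_left (1 : ℝ))
    exact (h1.mul h2).mul hh.continuous
  rw [← integral_Ioc_eq_integral_Ioo, ← intervalIntegral.integral_of_le zero_le_one,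
    intervalIntegral.integral_eq_sub_of_hasDerivAt_of_le zero_le_one hcF.continuousOn hF]
  · simp [Real.zero_rpow ha.ne', Real.zero_rpow hb.ne']
  · rwa [intervalIntegrable_iff_integrableOn_Ioo_of_le zero_le_one]

/-- A nonnegative function on `(0, ∞)` with limit `0` at `0` and `E' ≤ K E` vanishes. -/
theorem eq_zero_of_deriv_le_mul_of_tendsto_zero {E E' : ℝ → ℝ} {K : ℝ}
    (hE : ∀ t, 0 < t → HasDerivAt E (E' t) t) (hle : ∀ t, 0 < t → E' t ≤ K * E t)
    (hnn : ∀ t, 0 < t → 0 ≤ E t) (hlim : Filter.Tendsto E (nhdsWithin 0 (Set.Ioi 0)) (nhds 0))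
    {t : ℝ} (ht : 0 < t) : E t = 0 := by
  set F : ℝ → ℝ := fun t => Real.exp (-(K * t)) * E t with hF
  have hFd : ∀ t, 0 < t → HasDerivAt F (Real.exp (-(K * t)) * (E' t - K * E t)) t := by
    intro t ht
    have h1 : HasDerivAt (fun t : ℝ => Real.exp (-(K * t))) (Real.exp (-(K * t)) * (-(K * 1))) t :=
      ((hasDerivAt_id t).const_mul K).neg.exp
    exact (h1.mul (hE t ht)).congr_deriv (by ring)
  have hanti : AntitoneOn F (Set.Ioi 0) := by
    refine antitoneOn_of_deriv_nonpos (convex_Ioi 0)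
      (fun t ht => (hFd t ht).continuousAt.continuousWithinAt) ?_ ?_
    · rw [interior_Ioi]
      exact fun t ht => (hFd t ht).differentiableAt.differentiableWithinAt
    · rw [interior_Ioi]
      intro t ht
      rw [(hFd t ht).deriv]
      exact mul_nonpos_of_nonneg_of_nonpos (Real.exp_pos _).le (by linarith [hle t ht])
  have hFlim : Filter.Tendsto F (nhdsWithin 0 (Set.Ioi 0)) (nhds 0) := by
    have h1 : Filter.Tendsto (fun t : ℝ => Real.exp (-(K * t))) (nhdsWithin 0 (Set.Ioi 0))
        (nhds (Real.exp (-(K * 0)))) :=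
      ((by fun_prop : Continuous fun t : ℝ => Real.exp (-(K * t))).tendsto 0).mono_left
        nhdsWithin_le_nhds
    simpa using h1.mul hlim
  have hle0 : F t ≤ 0 := by
    refine ge_of_tendsto hFlim ?_
    filter_upwards [Ioo_mem_nhdsGT ht] with s hs
    exact hanti hs.1 ht hs.2.le
  have : E t ≤ 0 := by
    by_contra h
    exact absurd hle0 (not_le.2 (mul_pos (Real.exp_pos _) (not_le.1 h)))
  exact le_antisymm this (hnn t ht)

open Complex in
/-- The solution of the hypergeometric equation
`t (t + i) ψ'' + ((p + c) t + i c) ψ' + q ψ = 0` on `[0, ∞)` that vanishes at `0` and is twice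
differentiable up to `0` is zero, when `c > 0`. -/
theorem eq_zero_of_singular_ode {c p q : ℝ} (hc : 0 < c) {ψ ψ₁ ψ₂ : ℝ → ℂ}
    (h1 : ∀ t, HasDerivAt ψ (ψ₁ t) t) (h2 : ∀ t, HasDerivAt ψ₁ (ψ₂ t) t)
    (hode : ∀ t : ℝ, t * (t + I) * ψ₂ t + ((p + c) * t + I * c) * ψ₁ t + q * ψ t = 0)
    (h0 : ψ 0 = 0) {t : ℝ} (ht : 0 < t) : ψ t = 0 := by
  have h10 : ψ₁ 0 = 0 := by
    have := hode 0
    simpa [h0, hc.ne'] using this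
  set E : ℝ → ℝ := fun t => ‖ψ₁ t‖ ^ 2 + ‖ψ t‖ ^ 2 / t with hEdef
  set E' : ℝ → ℝ := fun t => 2 * inner ℝ (ψ₁ t) (ψ₂ t) +
    (2 * inner ℝ (ψ t) (ψ₁ t) * t - ‖ψ t‖ ^ 2 * 1) / t ^ 2 with hE'def
  have hE : ∀ t, 0 < t → HasDerivAt E (E' t) t := fun t ht =>
    (h2 t).norm_sq.add ((h1 t).norm_sq.div (hasDerivAt_id t) ht.ne')
  have hlim : Filter.Tendsto E (nhdsWithin 0 (Set.Ioi 0)) (nhds 0) := by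
    have hA : Filter.Tendsto (fun t => ‖ψ₁ t‖ ^ 2) (nhdsWithin 0 (Set.Ioi 0)) (nhds 0) := by
      have : Filter.Tendsto (fun t => ‖ψ₁ t‖ ^ 2) (nhds 0) (nhds (‖ψ₁ 0‖ ^ 2)) :=
        (h2 0).continuousAt.norm.pow 2
      rw [h10, norm_zero, zero_pow two_ne_zero] at this
      exact this.mono_left nhdsWithin_le_nhds
    have hB : Filter.Tendsto (fun t => ‖ψ t‖ ^ 2 / t) (nhdsWithin 0 (Set.Ioi 0)) (nhds 0) := by
      have hd : HasDerivAt (fun t => ‖ψ t‖ ^ 2) 0 0 := by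
        simpa [h0] using (h1 0).norm_sq
      have := hd.tendsto_slope_zero_right
      refine this.congr fun t => ?_
      simp [h0, div_eq_inv_mul]
    simpa using hA.add hB
  have hkey : ∀ t, 0 < t → t * inner ℝ (ψ₁ t) (ψ₂ t) ≤
      -c * ‖ψ₁ t‖ ^ 2 + |p| * t * ‖ψ₁ t‖ ^ 2 + |q| * (‖ψ t‖ * ‖ψ₁ t‖) := by
    intro t ht
    have hti : (t + I : ℂ) ≠ 0 := by
      intro h
      have := congrArg Complex.im h
      simp at this
    have hnorm : 1 ≤ ‖(t + I : ℂ)‖ := by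
      have := Complex.abs_im_le_norm (t + I : ℂ)
      simpa using this
    have hsol : (t : ℝ) • ψ₂ t = (-c : ℝ) • ψ₁ t + (-(p * t / (t + I)) * ψ₁ t -
        q / (t + I) * ψ t) := by
      have := hode t
      simp only [real_smul]
      push_cast
      field_simp
      linear_combination this
    have hinner : t * inner ℝ (ψ₁ t) (ψ₂ t) = -c * ‖ψ₁ t‖ ^ 2 +
        inner ℝ (ψ₁ t) (-(p * t / (t + I)) * ψ₁ t - q / (t + I) * ψ t) := by
      rw [← real_inner_smul_right, hsol, inner_add_right, real_inner_smul_right,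
        real_inner_self_eq_norm_sq]
    have hb : ‖-(p * t / (t + I)) * ψ₁ t - q / (t + I) * ψ t‖ ≤ |p| * t * ‖ψ₁ t‖ + |q| * ‖ψ t‖ := by
      refine (norm_sub_le _ _).trans (add_le_add ?_ ?_)
      · rw [norm_mul, norm_neg, norm_div, norm_mul, norm_real, norm_real, Real.norm_eq_abs,
          Real.norm_eq_abs, abs_of_pos ht]
        exact mul_le_mul_of_nonneg_right (div_le_self (by positivity) hnorm) (norm_nonneg _)
      · rw [norm_mul, norm_div, norm_real, Real.norm_eq_abs]
        exact mul_le_mul_of_nonneg_right (div_le_self (by positivity) hnorm) (norm_nonneg _)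
    have hcs := (real_inner_le_norm (ψ₁ t) (-(p * t / (t + I)) * ψ₁ t - q / (t + I) * ψ t)).trans
      (mul_le_mul_of_nonneg_left hb (norm_nonneg _))
    rw [hinner]
    nlinarith [hcs]
  have hle : ∀ t, 0 < t → E' t ≤ (2 * |p| + 1 + q ^ 2 / (2 * c)) * E t := by
    intro t ht
    have k1 := hkey t ht
    have k2 := real_inner_le_norm (ψ t) (ψ₁ t)
    set x := ‖ψ₁ t‖
    set y := ‖ψ t‖
    have hx : 0 ≤ x := norm_nonneg _
    have hy : 0 ≤ y := norm_nonneg _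
    have k3 : inner ℝ (ψ₁ t) (ψ₂ t) ≤ |p| * x ^ 2 + q ^ 2 / (4 * c) * (y ^ 2 / t) := by
      have : t * inner ℝ (ψ₁ t) (ψ₂ t) ≤ t * (|p| * x ^ 2 + q ^ 2 / (4 * c) * (y ^ 2 / t)) := by
        refine k1.trans ?_
        have e : t * (|p| * x ^ 2 + q ^ 2 / (4 * c) * (y ^ 2 / t)) =
            |p| * t * x ^ 2 + q ^ 2 / (4 * c) * y ^ 2 := by field_simp
        have e2 : q ^ 2 / (4 * c) * y ^ 2 + c * x ^ 2 - |q| * (y * x) =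
            c * (x - |q| * y / (2 * c)) ^ 2 := by
          rw [← sq_abs q]
          field_simp
          ring
        have : 0 ≤ c * (x - |q| * y / (2 * c)) ^ 2 := by positivity
        rw [e]
        linarith
      exact le_of_mul_le_mul_left this ht
    have k4 : (2 * inner ℝ (ψ t) (ψ₁ t) * t - y ^ 2 * 1) / t ^ 2 ≤ x ^ 2 := by
      rw [div_le_iff₀ (by positivity)]
      nlinarith [sq_nonneg (x * t - y), mul_le_mul_of_nonneg_right k2 ht.le]
    have k5 : 0 ≤ y ^ 2 / t := by positivity
    have e3 : q ^ 2 / (2 * c) = 2 * (q ^ 2 / (4 * c)) := by field_simp; norm_num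
    have k6 : 0 ≤ q ^ 2 / (4 * c) := by positivity
    have k7 := abs_nonneg p
    simp only [hE'def, hEdef, e3]
    have k8 := mul_nonneg k7 k5
    have k9 := mul_nonneg k6 (sq_nonneg x)
    nlinarith
  have := eq_zero_of_deriv_le_mul_of_tendsto_zero hE hle (fun t ht => by positivity) hlim ht
  have h3 : ‖ψ t‖ ^ 2 / t = 0 :=
    ((add_eq_zero_iff_of_nonneg (by positivity) (by positivity)).1 this).2
  simpa [ht.ne'] using h3

theorem integrable_comp_mul_of_hasCompactSupport {P Q : Measure ℝ} [IsProbabilityMeasure P]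
    [IsProbabilityMeasure Q] {u : ℝ → ℝ} (hu : Continuous u) (hc : HasCompactSupport u) :
    Integrable (fun p : ℝ × ℝ => u (p.1 * p.2)) (P.prod Q) := by
  obtain ⟨C, hC⟩ := hc.exists_bound_of_continuous hu
  exact Integrable.of_bound (hu.comp (by fun_prop)).aestronglyMeasurable C
    (ae_of_all _ fun p => hC _)

theorem integrable_snd_mul_comp_mul_of_hasCompactSupport {P Q : Measure ℝ}
    [IsProbabilityMeasure P] [IsProbabilityMeasure Q] (hQ : Integrable (fun x => x) Q)
    {u : ℝ → ℝ} (hu : Continuous u) (hc : HasCompactSupport u) :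
    Integrable (fun p : ℝ × ℝ => p.2 * u (p.1 * p.2)) (P.prod Q) := by
  obtain ⟨C, hC⟩ := hc.exists_bound_of_continuous hu
  exact Integrable.mul_bdd (c := C) (hQ.comp_snd P)
    (hu.comp (by fun_prop)).aestronglyMeasurable (ae_of_all _ fun p => hC _)

/-- The Stein identity for compactly supported test functions, by the Stein identities of the two
factors and Fubini's theorem. -/
theorem integral_prod_steinBetaGamma_of_hasCompactSupport {a b r : ℝ} (ha : 0 < a) (hb : 0 < b)
    (hr : 0 < r) {f : ℝ → ℝ} (hf : ContDiff ℝ 2 f) (hc : HasCompactSupport f) :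
    ∫ p : ℝ × ℝ, steinBetaGamma a b r f (p.1 * p.2)
      ∂((betaMeasure a b).prod (gammaMeasure r 1)) = 0 := by
  have := isProbabilityMeasureBeta ha hb
  have := isProbabilityMeasure_gammaMeasure hr one_pos
  have hf1 : ContDiff ℝ 1 (deriv f) := by
    have : ContDiff ℝ (1 + 1) f := by simpa [one_add_one_eq_two] using hf
    exact (contDiff_succ_iff_deriv.1 this).2.2
  have hfd : Continuous (deriv f) := hf1.continuous
  have hfc : Continuous f := hf.continuous
  set k : ℝ → ℝ := fun y => y * deriv f y + a * f y with hk
  have hk1 : ContDiff ℝ 1 k := by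
    have := hf.of_le (m := 1) (by norm_num)
    fun_prop
  have hkc : HasCompactSupport k := (hc.deriv.mul_left).add hc.mul_left
  have hkd : ∀ y, deriv k y = y * iteratedDeriv 2 f y + (1 + a) * deriv f y := by
    intro y
    have h1 := (hf1.differentiable one_ne_zero y).hasDerivAt
    have h2 := (hf.differentiable two_ne_zero y).hasDerivAt
    have h3 := ((hasDerivAt_id y).mul h1).add (h2.const_mul a)
    have e : deriv k y = _ := h3.deriv
    rw [e, iteratedDeriv_succ, iteratedDeriv_one]
    simp only [id]
    ring
  have hkdc : Continuous (deriv k) := hk1.continuous_deriv le_rfl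
  have hid : Integrable (fun x : ℝ => x) (gammaMeasure r 1) := by
    simpa using integrable_pow_gammaMeasure hr 1
  have i1 : Integrable (fun p : ℝ × ℝ => p.1 * p.2 * deriv k (p.1 * p.2))
      ((betaMeasure a b).prod (gammaMeasure r 1)) :=
    integrable_comp_mul_of_hasCompactSupport (u := fun y => y * deriv k y) (by fun_prop)
      hkc.deriv.mul_left
  have i2 : Integrable (fun p : ℝ × ℝ => k (p.1 * p.2))
      ((betaMeasure a b).prod (gammaMeasure r 1)) :=
    integrable_comp_mul_of_hasCompactSupport hk1.continuous hkc
  have i3 : Integrable (fun p : ℝ × ℝ => p.2 * k (p.1 * p.2))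
      ((betaMeasure a b).prod (gammaMeasure r 1)) :=
    integrable_snd_mul_comp_mul_of_hasCompactSupport hid hk1.continuous hkc
  have i4 : Integrable (fun p : ℝ × ℝ => p.1 * p.2 * (p.1 * p.2 * deriv f (p.1 * p.2) +
      (a + b) * f (p.1 * p.2))) ((betaMeasure a b).prod (gammaMeasure r 1)) :=
    integrable_comp_mul_of_hasCompactSupport
      (u := fun y => y * (y * deriv f y + (a + b) * f y)) (by fun_prop)
      (((hc.deriv.mul_left).add hc.mul_left).mul_left)
  set H₁ : ℝ × ℝ → ℝ := fun p => p.1 * p.2 * deriv k (p.1 * p.2) + r * k (p.1 * p.2)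
    - p.2 * k (p.1 * p.2) with hH₁
  set H₂ : ℝ × ℝ → ℝ := fun p => p.2 * k (p.1 * p.2) -
    p.1 * p.2 * (p.1 * p.2 * deriv f (p.1 * p.2) + (a + b) * f (p.1 * p.2)) with hH₂
  have j1 : Integrable H₁ ((betaMeasure a b).prod (gammaMeasure r 1)) :=
    (i1.add (i2.const_mul r)).sub i3
  have j2 : Integrable H₂ ((betaMeasure a b).prod (gammaMeasure r 1)) := i3.sub i4
  have hsum : (fun p : ℝ × ℝ => steinBetaGamma a b r f (p.1 * p.2)) = fun p => H₁ p + H₂ p := by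
    funext p
    simp only [hH₁, hH₂]
    rw [hkd]
    simp only [steinBetaGamma, iteratedDeriv_one, hk]
    ring
  have z1 : ∫ p, H₁ p ∂((betaMeasure a b).prod (gammaMeasure r 1)) = 0 := by
    rw [integral_prod _ j1]
    refine integral_eq_zero_of_ae ?_
    filter_upwards [betaMeasure_ae_mem_Ioo (a := a) (b := b)] with x hx
    have hx0 : x ≠ 0 := hx.1.ne'
    have := integral_gammaMeasure_stein hr (h := fun g => k (x * g))
      (hk1.comp (by fun_prop)) (hkc.comp_homeomorph (Homeomorph.mulLeft₀ x hx0))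
    refine Eq.trans (integral_congr_ae (ae_of_all _ fun g => ?_)) this
    have hd : deriv (fun g => k (x * g)) g = x * deriv k (x * g) := by
      simpa using deriv_comp_mul_left x k g
    simp only [hH₁, hd]
    ring
  have z2 : ∫ p, H₂ p ∂((betaMeasure a b).prod (gammaMeasure r 1)) = 0 := by
    rw [integral_prod_symm _ j2]
    refine integral_eq_zero_of_ae (ae_of_all _ fun g => ?_)
    have h1 := hf.of_le (m := 1) (by norm_num)
    have := integral_betaMeasure_stein ha hb (h := fun x => f (x * g)) (h1.comp (by fun_prop))
    have e : ∀ x, H₂ (x, g) = g * (x * (1 - x) * deriv (fun x => f (x * g)) x +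
        (a - (a + b) * x) * f (x * g)) := by
      intro x
      have hd : deriv (fun x => f (x * g)) x = g * deriv f (x * g) := by
        simpa [mul_comm] using deriv_comp_mul_left g f x
      simp only [hH₂, hd, hk]
      ring
    simp only [e, integral_const_mul, this, mul_zero, Pi.zero_apply]
  rw [hsum, integral_add j1 j2, z1, z2, add_zero]

theorem ContDiffAt.hasDerivAt_iteratedDeriv_one {f : ℝ → ℝ} {y : ℝ} (h : ContDiffAt ℝ 2 f y) :
    HasDerivAt f (iteratedDeriv 1 f y) y := by
  rw [iteratedDeriv_one]
  exact (h.differentiableAt two_ne_zero).hasDerivAt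

theorem ContDiffAt.hasDerivAt_iteratedDeriv_two {f : ℝ → ℝ} {y : ℝ} (h : ContDiffAt ℝ 2 f y) :
    HasDerivAt (iteratedDeriv 1 f) (iteratedDeriv 2 f y) y := by
  rw [iteratedDeriv_succ (n := 1), iteratedDeriv_one]
  have h1 : ContDiffAt ℝ 1 (fderiv ℝ f) y := h.fderiv_right (by norm_num [one_add_one_eq_two])
  have h2 : DifferentiableAt ℝ (fun z => fderiv ℝ f z 1) y :=
    (h1.differentiableAt one_ne_zero).clm_apply (differentiableAt_const _)
  exact h2.hasDerivAt

/-- The logarithmic cut-off `y ↦ f y * χ (log y / s)` of a function on `(0, ∞)`, extended by `0`. -/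
noncomputable def logCutoff (χ : ℝ → ℝ) (s : ℝ) (f : ℝ → ℝ) (y : ℝ) : ℝ :=
  if 0 < y then f y * χ (Real.log y / s) else 0

theorem logCutoff_eventuallyEq {χ f : ℝ → ℝ} {s y : ℝ} (hy : 0 < y) :
    logCutoff χ s f =ᶠ[nhds y] fun y => f y * χ (Real.log y / s) := by
  filter_upwards [lt_mem_nhds hy] with z hz
  simp [logCutoff, hz]

theorem logCutoff_eq_zero {χ f : ℝ → ℝ} {s y : ℝ} (hs : 0 < s) (hχ : ∀ x, 2 ≤ |x| → χ x = 0)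
    (hy : y ∉ Set.Icc (Real.exp (-(2 * s))) (Real.exp (2 * s))) : logCutoff χ s f y = 0 := by
  by_cases h0 : 0 < y
  · rw [logCutoff, if_pos h0, hχ, mul_zero]
    by_contra hlt
    rw [not_le, abs_lt, lt_div_iff₀ hs, div_lt_iff₀ hs, Real.lt_log_iff_exp_lt h0,
      Real.log_lt_iff_lt_exp h0] at hlt
    refine hy ⟨?_, hlt.2.le⟩
    rw [← neg_mul]
    exact hlt.1.le
  · simp [logCutoff, h0]

theorem contDiff_logCutoff {χ f : ℝ → ℝ} {s : ℝ} (hs : 0 < s) (hχ : ∀ x, 2 ≤ |x| → χ x = 0)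
    (hχd : ContDiff ℝ 2 χ) (hf : ContDiffOn ℝ 2 f (Set.Ioi 0)) :
    ContDiff ℝ 2 (logCutoff χ s f) := by
  rw [contDiff_iff_contDiffAt]
  intro y
  by_cases hy : 0 < y
  · refine ContDiffAt.congr_of_eventuallyEq ?_ (logCutoff_eventuallyEq hy)
    have h1 : ContDiffAt ℝ 2 f y := hf.contDiffAt (Ioi_mem_nhds hy)
    have h2 : ContDiffAt ℝ 2 (fun y => Real.log y / s) y :=
      (Real.contDiffAt_log.2 hy.ne').div_const s
    exact h1.mul (hχd.contDiffAt.comp y h2)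
  · have : logCutoff χ s f =ᶠ[nhds y] fun _ => 0 := by
      filter_upwards [gt_mem_nhds ((not_lt.1 hy).trans_lt (Real.exp_pos (-(2 * s))))] with z hz
      exact logCutoff_eq_zero hs hχ fun h => absurd h.1 (not_le.2 hz)
    exact contDiffAt_const.congr_of_eventuallyEq this

theorem hasCompactSupport_logCutoff {χ f : ℝ → ℝ} {s : ℝ} (hs : 0 < s)
    (hχ : ∀ x, 2 ≤ |x| → χ x = 0) : HasCompactSupport (logCutoff χ s f) :=
  HasCompactSupport.intro isCompact_Icc fun _ hy => logCutoff_eq_zero hs hχ hy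

theorem steinBetaGamma_logCutoff {a b r : ℝ} {χ f : ℝ → ℝ} {s y : ℝ} (hs : 0 < s) (hy : 0 < y)
    (hχd : ContDiff ℝ 2 χ) (hf : ContDiffOn ℝ 2 f (Set.Ioi 0)) :
    steinBetaGamma a b r (logCutoff χ s f) y =
      χ (Real.log y / s) * steinBetaGamma a b r f y +
      iteratedDeriv 1 χ (Real.log y / s) *
        (2 * (y * iteratedDeriv 1 f y) + (a + r) * f y - y * f y) * s⁻¹ +
      iteratedDeriv 2 χ (Real.log y / s) * f y * (s⁻¹ * s⁻¹) := by
  have hlog : ∀ z : ℝ, 0 < z → HasDerivAt (fun z => Real.log z / s) (z⁻¹ / s) z := fun z hz =>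
    (Real.hasDerivAt_log hz.ne').div_const s
  have hfz : ∀ z : ℝ, 0 < z → ContDiffAt ℝ 2 f z := fun z hz => hf.contDiffAt (Ioi_mem_nhds hz)
  have hχ0 : ∀ z : ℝ, 0 < z → HasDerivAt (fun z => χ (Real.log z / s))
      (iteratedDeriv 1 χ (Real.log z / s) * (z⁻¹ / s)) z := fun z hz =>
    (hχd.contDiffAt.hasDerivAt_iteratedDeriv_one).comp z (hlog z hz)
  have hχ1 : ∀ z : ℝ, 0 < z → HasDerivAt (fun z => iteratedDeriv 1 χ (Real.log z / s))
      (iteratedDeriv 2 χ (Real.log z / s) * (z⁻¹ / s)) z := fun z hz =>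
    (hχd.contDiffAt.hasDerivAt_iteratedDeriv_two).comp z (hlog z hz)
  have d1 : ∀ z : ℝ, 0 < z → iteratedDeriv 1 (logCutoff χ s f) z =
      iteratedDeriv 1 f z * χ (Real.log z / s) +
        f z * (iteratedDeriv 1 χ (Real.log z / s) * (z⁻¹ / s)) := by
    intro z hz
    rw [iteratedDeriv_one (f := logCutoff χ s f), (logCutoff_eventuallyEq hz).deriv_eq]
    exact ((hfz z hz).hasDerivAt_iteratedDeriv_one.mul (hχ0 z hz)).deriv
  have d2 : iteratedDeriv 2 (logCutoff χ s f) y =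
      (iteratedDeriv 2 f y * χ (Real.log y / s) +
        iteratedDeriv 1 f y * (iteratedDeriv 1 χ (Real.log y / s) * (y⁻¹ / s))) +
      (iteratedDeriv 1 f y * (iteratedDeriv 1 χ (Real.log y / s) * (y⁻¹ / s)) +
        f y * (iteratedDeriv 2 χ (Real.log y / s) * (y⁻¹ / s) * (y⁻¹ / s) +
          iteratedDeriv 1 χ (Real.log y / s) * (-(y ^ 2)⁻¹ / s))) := by
    have he : iteratedDeriv 1 (logCutoff χ s f) =ᶠ[nhds y] fun z =>
        iteratedDeriv 1 f z * χ (Real.log z / s) +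
          f z * (iteratedDeriv 1 χ (Real.log z / s) * (z⁻¹ / s)) := by
      filter_upwards [lt_mem_nhds hy] with z hz using d1 z hz
    rw [iteratedDeriv_succ (f := logCutoff χ s f), he.deriv_eq]
    exact (((hfz y hy).hasDerivAt_iteratedDeriv_two.mul (hχ0 y hy)).add
      ((hfz y hy).hasDerivAt_iteratedDeriv_one.mul
        ((hχ1 y hy).mul ((hasDerivAt_inv hy.ne').div_const s)))).deriv
  rw [steinBetaGamma, steinBetaGamma, d2, d1 y hy, logCutoff, if_pos hy]
  field_simp
  ring

theorem continuous_steinBetaGamma {a b r : ℝ} {f : ℝ → ℝ} (hf : ContDiff ℝ 2 f) :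
    Continuous (steinBetaGamma a b r f) := by
  have h0 := hf.continuous
  have h1 := hf.continuous_iteratedDeriv 1 (by norm_num)
  have h2 := hf.continuous_iteratedDeriv 2 (by norm_num)
  unfold steinBetaGamma
  fun_prop

theorem continuousOn_steinBetaGamma {a b r : ℝ} {f : ℝ → ℝ} (hf : ContDiffOn ℝ 2 f (Set.Ioi 0)) :
    ContinuousOn (steinBetaGamma a b r f) (Set.Ioi 0) := by
  have h0 := hf.continuousOn
  have h1 : ContinuousOn (iteratedDeriv 1 f) (Set.Ioi 0) :=
    fun y hy => (hf.contDiffAt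
      (Ioi_mem_nhds hy)).hasDerivAt_iteratedDeriv_two.continuousAt.continuousWithinAt
  have h2 : ContinuousOn (iteratedDeriv 2 f) (Set.Ioi 0) :=
    (hf.continuousOn_iteratedDerivWithin (m := 2) (by norm_num) (uniqueDiffOn_Ioi 0)).congr
      fun y hy => (iteratedDerivWithin_of_isOpen isOpen_Ioi hy).symm
  unfold steinBetaGamma
  fun_prop

/-- The Stein operator applied to a function of the Stein class is integrable. -/
theorem integrable_steinBetaGamma {Ω : Type*} [MeasurableSpace Ω] {μ : Measure Ω} {Y : Ω → ℝ}
    {I : Set ℝ} {a b r : ℝ} {f : ℝ → ℝ} (hf : f ∈ steinClass 2 2 I μ Y) :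
    Integrable (fun ω => steinBetaGamma a b r f (Y ω)) μ := by
  have h := hf.2
  have h00 := h 0 (by norm_num) 0 (by norm_num)
  have h01 := h 0 (by norm_num) 1 (by norm_num)
  have h11 := h 1 (by norm_num) 1 (by norm_num)
  have h12 := h 1 (by norm_num) 2 (by norm_num)
  have h22 := h 2 (by norm_num) 2 (by norm_num)
  refine ((h22.add ((h11.const_mul (a + r + 1)).sub h12)).add
    ((h00.const_mul (a * r)).sub (h01.const_mul (a + b)))).congr (ae_of_all _ fun ω => ?_)
  simp only [steinBetaGamma, Pi.add_apply, Pi.sub_apply, iteratedDeriv_zero]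
  ring

/-- If the Stein identity holds for compactly supported test functions, then it holds on the whole
Stein class. -/
theorem integral_steinBetaGamma_of_forall_hasCompactSupport {Ω : Type*} [MeasurableSpace Ω]
    {μ : Measure Ω} {Y : Ω → ℝ} (hY : AEMeasurable Y μ) (hpos : ∀ᵐ ω ∂μ, 0 < Y ω) {a b r : ℝ}
    (hcomp : ∀ g : ℝ → ℝ, ContDiff ℝ 2 g → HasCompactSupport g →
      ∫ ω, steinBetaGamma a b r g (Y ω) ∂μ = 0)
    {f : ℝ → ℝ} (hf : f ∈ steinClass 2 2 (Set.Ioi 0) μ Y) :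
    ∫ ω, steinBetaGamma a b r f (Y ω) ∂μ = 0 := by
  have hfd : ContDiffOn ℝ 2 f (Set.Ioi 0) := hf.1
  let χ : ContDiffBump (0 : ℝ) := ⟨1, 2, one_pos, one_lt_two⟩
  have hχd : ContDiff ℝ 2 χ := χ.contDiff
  have hχz : ∀ x : ℝ, 2 ≤ |x| → χ x = 0 := fun x hx =>
    χ.zero_of_le_dist (by simpa [Real.dist_eq] using hx)
  have hχ0 : χ 0 = 1 := χ.one_of_mem_closedBall (by simp [χ])
  have hχc : HasCompactSupport χ := χ.hasCompactSupport
  have c1 : Continuous (iteratedDeriv 1 χ) := hχd.continuous_iteratedDeriv 1 (by norm_num)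
  have c2 : Continuous (iteratedDeriv 2 χ) := hχd.continuous_iteratedDeriv 2 (by norm_num)
  have s1 : HasCompactSupport (iteratedDeriv 1 χ) := by
    rw [iteratedDeriv_one]; exact hχc.deriv
  have s2 : HasCompactSupport (iteratedDeriv 2 χ) := by
    rw [iteratedDeriv_succ]; exact s1.deriv
  obtain ⟨C₀, hC₀⟩ := hχc.exists_bound_of_continuous hχd.continuous
  obtain ⟨C₁, hC₁⟩ := s1.exists_bound_of_continuous c1
  obtain ⟨C₂, hC₂⟩ := s2.exists_bound_of_continuous c2
  have i0 := integrable_steinBetaGamma (a := a) (b := b) (r := r) hf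
  have h00 : Integrable (fun ω => f (Y ω)) μ := by
    simpa using hf.2 0 (by norm_num) 0 (by norm_num)
  have h01 : Integrable (fun ω => Y ω * f (Y ω)) μ := by
    simpa using hf.2 0 (by norm_num) 1 (by norm_num)
  have h11 : Integrable (fun ω => Y ω * iteratedDeriv 1 f (Y ω)) μ := by
    simpa only [pow_one] using hf.2 1 (by norm_num) 1 (by norm_num)
  have i1 : Integrable (fun ω => 2 * (Y ω * iteratedDeriv 1 f (Y ω)) + (a + r) * f (Y ω)
      - Y ω * f (Y ω)) μ := ((h11.const_mul 2).add (h00.const_mul _)).sub h01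
  have hinv : Filter.Tendsto (fun n : ℕ => ((n : ℝ) + 1)⁻¹) Filter.atTop (nhds 0) := by
    simpa using tendsto_one_div_add_atTop_nhds_zero_nat (𝕜 := ℝ)
  have hspos : ∀ n : ℕ, (0 : ℝ) < n + 1 := fun n => by positivity
  have hlim := tendsto_integral_of_dominated_convergence (μ := μ)
    (F := fun (n : ℕ) ω => steinBetaGamma a b r (logCutoff χ (n + 1) f) (Y ω))
    (f := fun ω => steinBetaGamma a b r f (Y ω))
    (fun ω => C₀ * ‖steinBetaGamma a b r f (Y ω)‖ +
      C₁ * ‖2 * (Y ω * iteratedDeriv 1 f (Y ω)) + (a + r) * f (Y ω) - Y ω * f (Y ω)‖ +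
      C₂ * ‖f (Y ω)‖)
    (fun n => (continuous_steinBetaGamma
      (contDiff_logCutoff (hspos n) hχz hχd hfd)).comp_aestronglyMeasurable hY.aestronglyMeasurable)
    (((i0.norm.const_mul C₀).add (i1.norm.const_mul C₁)).add (h00.norm.const_mul C₂))
    (fun n => by
      filter_upwards [hpos] with ω hω
      have hs1 : ‖((n : ℝ) + 1)⁻¹‖ ≤ 1 := by
        rw [Real.norm_of_nonneg (by positivity)]
        exact inv_le_one_of_one_le₀ (by linarith [n.cast_nonneg (α := ℝ)])
      have hs2 : ‖((n : ℝ) + 1)⁻¹ * ((n : ℝ) + 1)⁻¹‖ ≤ 1 := by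
        rw [norm_mul]
        exact mul_le_one₀ hs1 (norm_nonneg _) hs1
      rw [steinBetaGamma_logCutoff (hspos n) hω hχd hfd]
      refine (norm_add₃_le).trans (add_le_add (add_le_add ?_ ?_) ?_)
      · rw [norm_mul]
        exact mul_le_mul_of_nonneg_right (hC₀ _) (norm_nonneg _)
      · rw [norm_mul, norm_mul]
        exact (mul_le_of_le_one_right (by positivity) hs1).trans
          (mul_le_mul_of_nonneg_right (hC₁ _) (norm_nonneg _))
      · rw [norm_mul, norm_mul (iteratedDeriv 2 _ _)]
        exact (mul_le_of_le_one_right (by positivity) hs2).trans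
          (mul_le_mul_of_nonneg_right (hC₂ _) (norm_nonneg _)))
    (by
      filter_upwards [hpos] with ω hω
      simp_rw [steinBetaGamma_logCutoff (hspos _) hω hχd hfd]
      have hu : Filter.Tendsto (fun n : ℕ => Real.log (Y ω) / ((n : ℝ) + 1)) Filter.atTop
          (nhds 0) := by
        simpa [div_eq_mul_inv] using hinv.const_mul (Real.log (Y ω))
      have t0 := (hχd.continuous.tendsto 0).comp hu
      have t1 := (c1.tendsto 0).comp hu
      have t2 := (c2.tendsto 0).comp hu
      have := ((t0.mul_const (steinBetaGamma a b r f (Y ω))).add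
        ((t1.mul_const (2 * (Y ω * iteratedDeriv 1 f (Y ω)) + (a + r) * f (Y ω)
          - Y ω * f (Y ω))).mul hinv)).add ((t2.mul_const (f (Y ω))).mul (hinv.mul hinv))
      simpa [hχ0] using this)
  have hz : ∀ n : ℕ, ∫ ω, steinBetaGamma a b r (logCutoff χ (n + 1) f) (Y ω) ∂μ = 0 := fun n =>
    hcomp _ (contDiff_logCutoff (hspos n) hχz hχd hfd) (hasCompactSupport_logCutoff (hspos n) hχz)
  simp_rw [hz] at hlim
  exact (tendsto_nhds_unique hlim tendsto_const_nhds)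

theorem mem_steinClass_of_bounded {Ω : Type*} [MeasurableSpace Ω] {μ : Measure Ω}
    [IsFiniteMeasure μ] {Y : Ω → ℝ} (hY : Measurable Y) (hY2 : Integrable (fun ω => Y ω ^ 2) μ)
    (I : Set ℝ) {f : ℝ → ℝ} (hf : ContDiff ℝ 2 f)
    (hb : ∀ t ≤ 2, ∃ C, ∀ y, ‖iteratedDeriv t f y‖ ≤ C) : f ∈ steinClass 2 2 I μ Y := by
  refine ⟨hf.contDiffOn, fun t ht j hj => ?_⟩
  obtain ⟨C, hC⟩ := hb t ht
  have hc : Continuous (iteratedDeriv t f) := hf.continuous_iteratedDeriv t (by exact_mod_cast ht)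
  have hL : MemLp Y 2 μ := (memLp_two_iff_integrable_sq hY.aestronglyMeasurable).2 hY2
  have hj' : Integrable (fun ω => Y ω ^ j) μ := by
    have h1 : MemLp Y j μ := hL.mono_exponent (by exact_mod_cast hj)
    exact (integrable_norm_iff (by fun_prop)).1 (by simpa using h1.integrable_norm_pow')
  exact hj'.mul_bdd (c := C) (hc.comp_aestronglyMeasurable hY.aestronglyMeasurable)
    (ae_of_all _ fun ω => hC _)

theorem iteratedDeriv_one_cos_mul (t : ℝ) :
    iteratedDeriv 1 (fun y => Real.cos (t * y)) = fun y => -(t * Real.sin (t * y)) := by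
  funext y
  rw [iteratedDeriv_one]
  refine (((hasDerivAt_id y).const_mul t).cos).deriv.trans ?_
  simp only [id]
  ring

theorem iteratedDeriv_one_sin_mul (t : ℝ) :
    iteratedDeriv 1 (fun y => Real.sin (t * y)) = fun y => t * Real.cos (t * y) := by
  funext y
  rw [iteratedDeriv_one]
  refine (((hasDerivAt_id y).const_mul t).sin).deriv.trans ?_
  simp only [id]
  ring

theorem iteratedDeriv_two_cos_mul (t : ℝ) :
    iteratedDeriv 2 (fun y => Real.cos (t * y)) = fun y => -(t ^ 2 * Real.cos (t * y)) := by
  funext y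
  rw [iteratedDeriv_succ, iteratedDeriv_one_cos_mul]
  refine (((hasDerivAt_id y).const_mul t).sin.const_mul t).neg.deriv.trans ?_
  simp only [id]
  ring

theorem iteratedDeriv_two_sin_mul (t : ℝ) :
    iteratedDeriv 2 (fun y => Real.sin (t * y)) = fun y => -(t ^ 2 * Real.sin (t * y)) := by
  funext y
  rw [iteratedDeriv_succ, iteratedDeriv_one_sin_mul]
  refine (((hasDerivAt_id y).const_mul t).cos.const_mul t).deriv.trans ?_
  simp only [id]
  ring

theorem contDiff_cos_mul (t : ℝ) : ContDiff ℝ 2 fun y => Real.cos (t * y) :=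
  Real.contDiff_cos.comp (by fun_prop)

theorem contDiff_sin_mul (t : ℝ) : ContDiff ℝ 2 fun y => Real.sin (t * y) :=
  Real.contDiff_sin.comp (by fun_prop)

theorem exists_bound_iteratedDeriv_cos_mul (t : ℝ) (k : ℕ) (hk : k ≤ 2) :
    ∃ C, ∀ y, ‖iteratedDeriv k (fun y => Real.cos (t * y)) y‖ ≤ C := by
  interval_cases k
  · exact ⟨1, fun y => by simpa using Real.abs_cos_le_one _⟩
  · refine ⟨|t|, fun y => ?_⟩
    rw [iteratedDeriv_one_cos_mul, norm_neg, norm_mul]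
    exact mul_le_of_le_one_right (norm_nonneg _) (Real.abs_sin_le_one _)
  · refine ⟨‖t ^ 2‖, fun y => ?_⟩
    rw [iteratedDeriv_two_cos_mul, norm_neg, norm_mul]
    exact mul_le_of_le_one_right (norm_nonneg _) (Real.abs_cos_le_one _)

theorem exists_bound_iteratedDeriv_sin_mul (t : ℝ) (k : ℕ) (hk : k ≤ 2) :
    ∃ C, ∀ y, ‖iteratedDeriv k (fun y => Real.sin (t * y)) y‖ ≤ C := by
  interval_cases k
  · exact ⟨1, fun y => by simpa using Real.abs_sin_le_one _⟩
  · refine ⟨|t|, fun y => ?_⟩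
    rw [iteratedDeriv_one_sin_mul, norm_mul]
    exact mul_le_of_le_one_right (norm_nonneg _) (Real.abs_cos_le_one _)
  · refine ⟨‖t ^ 2‖, fun y => ?_⟩
    rw [iteratedDeriv_two_sin_mul, norm_neg, norm_mul]
    exact mul_le_of_le_one_right (norm_nonneg _) (Real.abs_sin_le_one _)

open Complex in
theorem steinBetaGamma_cos_add_sin (a b r t y : ℝ) :
    (steinBetaGamma a b r (fun y => Real.cos (t * y)) y : ℂ) +
      I * (steinBetaGamma a b r (fun y => Real.sin (t * y)) y : ℂ) =
    -(t * (t + I)) * ((y : ℂ) ^ 2 * exp (t * y * I)) +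
      ((a + r + 1) * t * I - (a + b)) * ((y : ℂ) ^ 1 * exp (t * y * I)) +
      a * r * ((y : ℂ) ^ 0 * exp (t * y * I)) := by
  have he : exp (t * y * I) = (Real.cos (t * y) : ℂ) + (Real.sin (t * y) : ℂ) * I := by
    rw [exp_mul_I]
    push_cast
    rfl
  rw [he]
  simp only [steinBetaGamma, iteratedDeriv_one_cos_mul, iteratedDeriv_one_sin_mul,
    iteratedDeriv_two_cos_mul, iteratedDeriv_two_sin_mul]
  push_cast
  linear_combination (-(Complex.sin (t * y)) * t * ((a + r + 1) * y - y ^ 2)) * I_sq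

open Complex in
/-- The Stein identity for trigonometric test functions is a differential equation for the
characteristic function. -/
theorem charFun_ode_of_stein {P : Measure ℝ} [IsProbabilityMeasure P] {a b r : ℝ}
    (hP : MemLp id 2 P)
    (hic : ∀ t, Integrable (steinBetaGamma a b r fun y => Real.cos (t * y)) P)
    (his : ∀ t, Integrable (steinBetaGamma a b r fun y => Real.sin (t * y)) P)
    (hcos : ∀ t, ∫ y, steinBetaGamma a b r (fun y => Real.cos (t * y)) y ∂P = 0)
    (hsin : ∀ t, ∫ y, steinBetaGamma a b r (fun y => Real.sin (t * y)) y ∂P = 0) (t : ℝ) :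
    t * (t + I) * iteratedDeriv 2 (charFun P) t +
      ((a + r + 1) * t + I * (a + b)) * iteratedDeriv 1 (charFun P) t +
      a * r * charFun P t = 0 := by
  have hn : ∀ n : ℕ, n ≤ 2 → MemLp id n P := fun n hn => hP.mono_exponent (by exact_mod_cast hn)
  have hint : ∀ n : ℕ, n ≤ 2 → Integrable (fun y : ℝ => (y : ℂ) ^ n * exp (t * y * I)) P := by
    intro n h
    have h1 : Integrable (fun y : ℝ => ‖y‖ ^ n) P := (hn n h).integrable_norm_pow'
    refine h1.mono' (by fun_prop) (ae_of_all _ fun y => ?_)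
    rw [norm_mul, norm_pow, norm_real, ← ofReal_mul, norm_exp_ofReal_mul_I, mul_one]
  have h0 : charFun P t = I ^ 0 * ∫ x : ℝ, (x : ℂ) ^ 0 * exp (t * x * I) ∂P := by
    rw [← iteratedDeriv_charFun (hn 0 (by norm_num)), iteratedDeriv_zero]
  rw [h0, iteratedDeriv_charFun (hn 1 (by norm_num)), iteratedDeriv_charFun (hn 2 le_rfl)]
  have key : ∫ y : ℝ, ((steinBetaGamma a b r (fun y => Real.cos (t * y)) y : ℂ) +
      I * (steinBetaGamma a b r (fun y => Real.sin (t * y)) y : ℂ)) ∂P = 0 := by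
    have jc : Integrable (fun y => (steinBetaGamma a b r (fun y => Real.cos (t * y)) y : ℂ)) P :=
      (hic t).ofReal
    have js : Integrable (fun y => (steinBetaGamma a b r (fun y => Real.sin (t * y)) y : ℂ)) P :=
      (his t).ofReal
    rw [integral_add jc (js.const_mul I), integral_const_mul, integral_complex_ofReal,
      integral_complex_ofReal, hcos, hsin]
    simp
  simp_rw [steinBetaGamma_cos_add_sin] at key
  have i2 := (hint 2 le_rfl).const_mul (-(t * (t + I)))
  have i1 := (hint 1 (by norm_num)).const_mul ((a + r + 1) * t * I - (a + b))
  have i0 := (hint 0 (by norm_num)).const_mul (a * r : ℂ)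
  rw [integral_add (by exact i2.add i1) i0, integral_add i2 i1, integral_const_mul, integral_const_mul,
    integral_const_mul] at key
  linear_combination key + (t * (t + I) * (∫ y : ℝ, (y : ℂ) ^ 2 * exp (t * y * I) ∂P)
    + (a + b) * (∫ y : ℝ, (y : ℂ) ^ 1 * exp (t * y * I) ∂P)) * I_sq

open Complex in
/-- The differential equation determines the distribution. -/
theorem measure_eq_of_charFun_ode {P Q : Measure ℝ} [IsProbabilityMeasure P]
    [IsProbabilityMeasure Q] {a b r : ℝ} (hc : 0 < a + b) (hP : MemLp id 2 P) (hQ : MemLp id 2 Q)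
    (hPo : ∀ t : ℝ, t * (t + I) * iteratedDeriv 2 (charFun P) t +
      ((a + r + 1) * t + I * (a + b)) * iteratedDeriv 1 (charFun P) t + a * r * charFun P t = 0)
    (hQo : ∀ t : ℝ, t * (t + I) * iteratedDeriv 2 (charFun Q) t +
      ((a + r + 1) * t + I * (a + b)) * iteratedDeriv 1 (charFun Q) t + a * r * charFun Q t = 0) :
    P = Q := by
  have hder : ∀ R : Measure ℝ, IsProbabilityMeasure R → MemLp id 2 R →
      (∀ t, HasDerivAt (charFun R) (iteratedDeriv 1 (charFun R) t) t) ∧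
      ∀ t, HasDerivAt (iteratedDeriv 1 (charFun R)) (iteratedDeriv 2 (charFun R) t) t := by
    intro R _ hR
    have h : ContDiff ℝ 2 (charFun R) := contDiff_charFun (n := 2) hR
    constructor
    · intro t
      rw [iteratedDeriv_one]
      exact (h.differentiable two_ne_zero t).hasDerivAt
    · intro t
      rw [iteratedDeriv_succ (n := 1)]
      exact (h.differentiable_iteratedDeriv 1 (by norm_num) t).hasDerivAt
  have hpos : ∀ t : ℝ, 0 < t → charFun P t = charFun Q t := by
    intro t ht
    refine sub_eq_zero.1 (eq_zero_of_singular_ode (c := a + b) (p := r + 1 - b) (q := a * r) hc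
      (ψ := fun t => charFun P t - charFun Q t)
      (fun t => ((hder P inferInstance hP).1 t).sub ((hder Q inferInstance hQ).1 t))
      (fun t => ((hder P inferInstance hP).2 t).sub ((hder Q inferInstance hQ).2 t))
      (fun t => ?_) (by simp) ht)
    push_cast
    linear_combination hPo t - hQo t
  refine Measure.ext_of_charFun (funext fun t => ?_)
  rcases lt_trichotomy t 0 with h | h | h
  · have := hpos (-t) (by linarith)
    rw [charFun_neg, charFun_neg] at this
    exact (starRingEnd ℂ).injective this
  · simp [h]
  · exact hpos t h

/-- Stein characterisation of the product of independent `Beta(a, b)` and `Γ(r, 1)` random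
variables. The first two items are the characterisation with test functions on `(0, ∞)`, for which
`S f(W)` only makes sense when `W` lies in `(0, ∞)` almost surely; the last item shows that for an
arbitrary real-valued `W` the test functions that are defined and `C²` on all of `ℝ` suffice. -/
theorem stein_characterisation_beta_times_gamma
    {Ω Ω' : Type*} [MeasurableSpace Ω] [MeasurableSpace Ω']
    (μ : Measure Ω) [IsProbabilityMeasure μ] (ν : Measure Ω') [IsProbabilityMeasure ν]
    (a b r : ℝ) (ha : 0 < a) (hb : 0 < b) (hr : 0 < r)
    (B G : Ω → ℝ) (hB : Measurable B) (hG : Measurable G)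
    (hBlaw : Measure.map B μ = betaMeasure a b)
    (hGlaw : Measure.map G μ = gammaMeasure r 1)
    (hindep : IndepFun B G μ)
    (W : Ω' → ℝ) (hW : Measurable W)
    (hWmom : Integrable (fun ω => W ω ^ 2) ν) :
    List.TFAE [
      Measure.map W ν = Measure.map (fun ω => B ω * G ω) μ,
      (∀ᵐ ω ∂ν, W ω ∈ Set.Ioi (0 : ℝ)) ∧
        ∀ f ∈ steinClass 2 2 (Set.Ioi 0) μ (fun ω => B ω * G ω),
          Integrable (fun ω => steinBetaGamma a b r f (W ω)) ν ∧
            ∫ ω, steinBetaGamma a b r f (W ω) ∂ν = 0,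
      ∀ f ∈ steinClass 2 2 (Set.Ioi 0) μ (fun ω => B ω * G ω), ContDiff ℝ 2 f →
        Integrable (fun ω => steinBetaGamma a b r f (W ω)) ν →
          ∫ ω, steinBetaGamma a b r f (W ω) ∂ν = 0] := by
  have hY : Measurable fun ω => B ω * G ω := hB.mul hG
  have hBmem : ∀ᵐ ω ∂μ, B ω ∈ Set.Ioo (0 : ℝ) 1 :=
    ae_of_ae_map hB.aemeasurable (hBlaw ▸ betaMeasure_ae_mem_Ioo)
  have hGpos : ∀ᵐ ω ∂μ, 0 < G ω :=
    ae_of_ae_map hG.aemeasurable (hGlaw ▸ gammaMeasure_ae_pos)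
  have hYpos : ∀ᵐ ω ∂μ, 0 < B ω * G ω := by
    filter_upwards [hBmem, hGpos] with ω h1 h2 using mul_pos h1.1 h2
  have hG2 : Integrable (fun ω => G ω ^ 2) μ := by
    have := integrable_pow_gammaMeasure hr 2
    rw [← hGlaw] at this
    exact this.comp_measurable hG
  have hY2 : Integrable (fun ω => (B ω * G ω) ^ 2) μ := by
    refine hG2.mono' (by fun_prop) ?_
    filter_upwards [hBmem] with ω h1
    rw [Real.norm_of_nonneg (sq_nonneg _), mul_pow]
    exact mul_le_of_le_one_left (sq_nonneg _) (pow_le_one₀ h1.1.le h1.2.le)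
  have hcomp : ∀ g : ℝ → ℝ, ContDiff ℝ 2 g → HasCompactSupport g →
      ∫ ω, steinBetaGamma a b r g (B ω * G ω) ∂μ = 0 := by
    intro g hg hgc
    have h := integral_prod_steinBetaGamma_of_hasCompactSupport ha hb hr hg hgc
    rw [← hBlaw, ← hGlaw, ← (indepFun_iff_map_prod_eq_prod_map_map hB.aemeasurable
      hG.aemeasurable).1 hindep, integral_map (by fun_prop)] at h
    · exact h
    · exact ((continuous_steinBetaGamma hg).comp (by fun_prop)).aestronglyMeasurable
  have hstein : ∀ f ∈ steinClass 2 2 (Set.Ioi 0) μ (fun ω => B ω * G ω),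
      ∫ ω, steinBetaGamma a b r f (B ω * G ω) ∂μ = 0 := fun f hf =>
    integral_steinBetaGamma_of_forall_hasCompactSupport hY.aemeasurable hYpos hcomp hf
  tfae_have 1 → 2 := by
    intro h
    have hpos : ∀ᵐ y ∂(Measure.map W ν), y ∈ Set.Ioi (0 : ℝ) := by
      rw [h]
      exact (ae_map_iff hY.aemeasurable measurableSet_Ioi).2 hYpos
    refine ⟨ae_of_ae_map hW.aemeasurable hpos, fun f hf => ?_⟩
    have hm : AEStronglyMeasurable (steinBetaGamma a b r f) (Measure.map W ν) := by
      rw [← Measure.restrict_eq_self_of_ae_mem hpos]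
      exact (continuousOn_steinBetaGamma hf.1).aestronglyMeasurable measurableSet_Ioi
    have hm' := h ▸ hm
    constructor
    · have hi : Integrable (steinBetaGamma a b r f) (Measure.map W ν) := by
        rw [h, integrable_map_measure hm' hY.aemeasurable]
        exact integrable_steinBetaGamma hf
      exact hi.comp_measurable hW
    · rw [← integral_map hW.aemeasurable hm, h, integral_map hY.aemeasurable hm']
      exact hstein f hf
  tfae_have 2 → 3 := fun h f hf _ _ => (h.2 f hf).2
  tfae_have 3 → 1 := by
    intro h
    have hc := contDiff_cos_mul
    have hs := contDiff_sin_mul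
    have mYc : ∀ (I : Set ℝ) t, (fun y => Real.cos (t * y)) ∈ steinClass 2 2 I μ
        (fun ω => B ω * G ω) := fun I t =>
      mem_steinClass_of_bounded hY hY2 I (hc t) (exists_bound_iteratedDeriv_cos_mul t)
    have mYs : ∀ (I : Set ℝ) t, (fun y => Real.sin (t * y)) ∈ steinClass 2 2 I μ
        (fun ω => B ω * G ω) := fun I t =>
      mem_steinClass_of_bounded hY hY2 I (hs t) (exists_bound_iteratedDeriv_sin_mul t)
    have iWc : ∀ t, Integrable (fun ω => steinBetaGamma a b r (fun y => Real.cos (t * y)) (W ω)) ν :=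
      fun t => integrable_steinBetaGamma (mem_steinClass_of_bounded hW hWmom Set.univ (hc t)
        (exists_bound_iteratedDeriv_cos_mul t))
    have iWs : ∀ t, Integrable (fun ω => steinBetaGamma a b r (fun y => Real.sin (t * y)) (W ω)) ν :=
      fun t => integrable_steinBetaGamma (mem_steinClass_of_bounded hW hWmom Set.univ (hs t)
        (exists_bound_iteratedDeriv_sin_mul t))
    have cc := fun t => (continuous_steinBetaGamma (a := a) (b := b) (r := r) (hc t)).measurable
    have cs := fun t => (continuous_steinBetaGamma (a := a) (b := b) (r := r) (hs t)).measurable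
    have := Measure.isProbabilityMeasure_map (μ := ν) hW.aemeasurable
    have := Measure.isProbabilityMeasure_map (μ := μ) hY.aemeasurable
    have lW : MemLp id 2 (Measure.map W ν) := by
      rw [memLp_map_measure_iff (by fun_prop) hW.aemeasurable]
      exact (memLp_two_iff_integrable_sq hW.aestronglyMeasurable).2 hWmom
    have lY : MemLp id 2 (Measure.map (fun ω => B ω * G ω) μ) := by
      rw [memLp_map_measure_iff (by fun_prop) hY.aemeasurable]
      exact (memLp_two_iff_integrable_sq hY.aestronglyMeasurable).2 hY2
    refine measure_eq_of_charFun_ode (a := a) (b := b) (r := r) (by positivity) lW lY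
      (charFun_ode_of_stein lW (fun t => ?_) (fun t => ?_) (fun t => ?_) (fun t => ?_))
      (charFun_ode_of_stein lY (fun t => ?_) (fun t => ?_) (fun t => ?_) (fun t => ?_))
    · exact (integrable_map_measure (cc t).aestronglyMeasurable hW.aemeasurable).2 (iWc t)
    · exact (integrable_map_measure (cs t).aestronglyMeasurable hW.aemeasurable).2 (iWs t)
    · rw [integral_map hW.aemeasurable (cc t).aestronglyMeasurable]
      exact h _ (mYc _ t) (hc t) (iWc t)
    · rw [integral_map hW.aemeasurable (cs t).aestronglyMeasurable]
      exact h _ (mYs _ t) (hs t) (iWs t)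
    · exact (integrable_map_measure (cc t).aestronglyMeasurable hY.aemeasurable).2
        (integrable_steinBetaGamma (mYc Set.univ t))
    · exact (integrable_map_measure (cs t).aestronglyMeasurable hY.aemeasurable).2
        (integrable_steinBetaGamma (mYs Set.univ t))
    · rw [integral_map hY.aemeasurable (cc t).aestronglyMeasurable]
      exact hstein _ (mYc _ t)
    · rw [integral_map hY.aemeasurable (cs t).aestronglyMeasurable]
      exact hstein _ (mYs _ t)
  tfae_finish
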